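/- Let k be a field and A an 𝔸²-form over k with respect to some field extension L/k. Then A ≅ k^{[2]} if and only if the Makar-Limanov invariant ML(A) equals k. -/

import Mathlib

/-- An exponential map (equivalently, a `𝔾ₐ`-action) on a `k`-algebra `A`:
a `k`-algebra homomorphism `φ : A → A[U]` such that evaluation at `U = 0`
is the identity and the coaction axiom `φ_V ∘ φ_U = φ_{U+V}` holds. -/
structure ExpMap (k A : Type*) [Field k] [CommRing A] [Algebra k A] where
  toFun : A →ₐ[k] Polynomial A
  eval_zero : ∀ a : A, (toFun a).eval 0 = a
  coaction : ∀ a : A,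
    (toFun a).map (toFun.toRingHom) =
      (toFun a).eval₂ (Polynomial.C.comp Polynomial.C)
        (Polynomial.X + Polynomial.C Polynomial.X)

variable {k A : Type*} [Field k] [CommRing A] [Algebra k A]

/-- The ring of invariants `A^φ = {a ∈ A : φ(a) = a}` of an exponential map. -/
def ExpMap.invariants (φ : ExpMap k A) : Subalgebra k A where
  carrier := {a : A | φ.toFun a = Polynomial.C a}
  mul_mem' := by
    intro a b ha hb
    simp only [Set.mem_setOf_eq, map_mul] at *
    rw [ha, hb]
  add_mem' := by
    intro a b ha hb
    simp only [Set.mem_setOf_eq, map_add] at *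
    rw [ha, hb]
  algebraMap_mem' := by
    intro r
    simp only [Set.mem_setOf_eq, AlgHom.commutes, Polynomial.algebraMap_apply]

/-- An exponential map is nontrivial if its ring of invariants is a proper subring. -/
def ExpMap.Nontrivial (φ : ExpMap k A) : Prop := ∃ a : A, φ.toFun a ≠ Polynomial.C a

namespace ExpMap

open Polynomial

/-- The degree of `a` with respect to an exponential map `φ`: the `U`-degree of `φ a`. -/
noncomputable def deg (φ : ExpMap k A) (a : A) : ℕ := (φ.toFun a).natDegree

theorem mem_invariants {φ : ExpMap k A} {a : A} : a ∈ φ.invariants ↔ φ.toFun a = C a := Iff.rfl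

theorem coeff_zero (φ : ExpMap k A) (a : A) : (φ.toFun a).coeff 0 = a := by
  rw [coeff_zero_eq_eval_zero, φ.eval_zero]

theorem mem_invariants_iff_deg {φ : ExpMap k A} {a : A} : a ∈ φ.invariants ↔ φ.deg a = 0 := by
  rw [mem_invariants, deg]
  refine ⟨fun h => by rw [h, natDegree_C], fun h => ?_⟩
  rw [eq_C_of_natDegree_eq_zero h, coeff_zero]

theorem injective (φ : ExpMap k A) : Function.Injective φ.toFun := fun a b h => by
  rw [← φ.eval_zero a, h, φ.eval_zero]

theorem toFun_ne_zero (φ : ExpMap k A) {a : A} (ha : a ≠ 0) : φ.toFun a ≠ 0 := fun h =>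
  ha (φ.injective (by rw [h, map_zero]))

/-- The coaction identity, read off on coefficients. -/
theorem coeff_toFun_coeff (φ : ExpMap k A) (a : A) (i l : ℕ) :
    (φ.toFun ((φ.toFun a).coeff i)).coeff l =
      ((l + i).choose i : A) * (φ.toFun a).coeff (l + i) := by
  have h := congrArg (fun p => (p.coeff i).coeff l) (φ.coaction a)
  simp only [coeff_map] at h
  have h2 : (φ.toFun a).eval₂ (C.comp C) (X + C X) = taylor X ((φ.toFun a).map C) := by
    rw [taylor_apply, comp, eval₂_map]
  rw [h2, taylor_coeff] at h
  have h3 : hasseDeriv i ((φ.toFun a).map C) = (hasseDeriv i (φ.toFun a)).map C := by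
    ext n : 1
    simp [hasseDeriv_coeff, coeff_map]
  rw [h3, eval_map] at h
  change (φ.toFun ((φ.toFun a).coeff i)).coeff l = _ at h
  rw [h, eval₂_C_X, hasseDeriv_coeff]

/-- The leading coefficient of `φ a`. -/
noncomputable def lead (φ : ExpMap k A) (a : A) : A := (φ.toFun a).leadingCoeff

theorem lead_ne_zero (φ : ExpMap k A) {a : A} (ha : a ≠ 0) : φ.lead a ≠ 0 :=
  leadingCoeff_ne_zero.mpr (φ.toFun_ne_zero ha)

theorem deg_coeff_le (φ : ExpMap k A) (a : A) (i : ℕ) :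
    φ.deg ((φ.toFun a).coeff i) ≤ φ.deg a - i := by
  refine natDegree_le_iff_coeff_eq_zero.mpr fun l hl => ?_
  rw [coeff_toFun_coeff, coeff_eq_zero_of_natDegree_lt, mul_zero]
  have : φ.deg a = (φ.toFun a).natDegree := rfl
  omega

theorem coeff_mem_invariants (φ : ExpMap k A) {a : A} {n : ℕ} (h : φ.deg a ≤ n) :
    (φ.toFun a).coeff n ∈ φ.invariants := by
  rw [mem_invariants_iff_deg]
  have := φ.deg_coeff_le a n
  omega

theorem lead_mem_invariants (φ : ExpMap k A) (a : A) : φ.lead a ∈ φ.invariants :=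
  φ.coeff_mem_invariants le_rfl

theorem deg_sub_algebraMap (φ : ExpMap k A) (a : A) (c : k) :
    φ.deg (a - algebraMap k A c) = φ.deg a := by
  rw [deg, map_sub, mem_invariants.mp (φ.invariants.algebraMap_mem c), natDegree_sub_C, deg]

/-- An element whose degree is bounded by `n` drops in degree once its `n`-th coefficient
vanishes. -/
theorem deg_lt_of_coeff_eq_zero (φ : ExpMap k A) {a : A} {n : ℕ} (hn : 0 < n) (h : φ.deg a ≤ n)
    (h0 : (φ.toFun a).coeff n = 0) : φ.deg a < n := by
  refine lt_of_le_of_ne h fun e => ?_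
  subst e
  have : φ.toFun a = 0 := leadingCoeff_eq_zero.mp h0
  rw [deg, this, natDegree_zero] at hn
  exact hn.false

theorem ne_zero_of_deg_pos (φ : ExpMap k A) {a : A} (h : 0 < φ.deg a) : a ≠ 0 := by
  rintro rfl
  rw [deg, map_zero, natDegree_zero] at h
  exact h.false

section Domain

variable [IsDomain A]

theorem deg_mul (φ : ExpMap k A) {a b : A} (ha : a ≠ 0) (hb : b ≠ 0) :
    φ.deg (a * b) = φ.deg a + φ.deg b := by
  rw [deg, map_mul, natDegree_mul (φ.toFun_ne_zero ha) (φ.toFun_ne_zero hb), deg, deg]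

theorem lead_mul (φ : ExpMap k A) (a b : A) : φ.lead (a * b) = φ.lead a * φ.lead b := by
  rw [lead, map_mul, leadingCoeff_mul, lead, lead]

theorem lead_pow (φ : ExpMap k A) (a : A) (n : ℕ) : φ.lead (a ^ n) = φ.lead a ^ n := by
  rw [lead, map_pow, leadingCoeff_pow, lead]

theorem deg_pow (φ : ExpMap k A) (a : A) (n : ℕ) : φ.deg (a ^ n) = n * φ.deg a := by
  rw [deg, map_pow, natDegree_pow, deg]

/-- Rings of invariants are factorially closed. -/
theorem mem_invariants_of_mul_mem (φ : ExpMap k A) {a b : A} (h : a * b ∈ φ.invariants)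
    (h0 : a * b ≠ 0) : a ∈ φ.invariants ∧ b ∈ φ.invariants := by
  simp only [mem_invariants_iff_deg] at h ⊢
  rw [φ.deg_mul (left_ne_zero_of_mul h0) (right_ne_zero_of_mul h0)] at h
  omega

theorem deg_eq_zero_of_isUnit (φ : ExpMap k A) {a : A} (h : IsUnit a) : φ.deg a = 0 := by
  obtain ⟨b, hb⟩ := h.exists_right_inv
  refine mem_invariants_iff_deg.mp (φ.mem_invariants_of_mul_mem (b := b) ?_ ?_).1
  · rw [hb]; exact φ.invariants.one_mem
  · rw [hb]; exact one_ne_zero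

/-- The ring of invariants is algebraically closed. -/
theorem mem_invariants_of_aeval_eq_zero (φ : ExpMap k A) {a : A} {p : Polynomial φ.invariants}
    (hp : p ≠ 0) (h : aeval a p = 0) : a ∈ φ.invariants := by
  have hC : φ.toFun.toRingHom.comp (algebraMap φ.invariants A) =
      C.comp (algebraMap φ.invariants A) := by
    ext1 b
    exact b.2
  have h1 : (p.map (algebraMap φ.invariants A)).comp (φ.toFun a) = 0 := by
    have h2 := congrArg φ.toFun.toRingHom h
    rw [aeval_def, hom_eval₂, hC, map_zero] at h2
    rw [comp, eval₂_map]
    exact h2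
  have hinj : Function.Injective (algebraMap φ.invariants A) := Subtype.val_injective
  have h2 := congrArg natDegree h1
  rw [natDegree_comp, natDegree_zero, natDegree_map_eq_of_injective hinj, mul_eq_zero] at h2
  rcases h2 with h2 | h2
  · exfalso
    rw [eq_C_of_natDegree_eq_zero h2, aeval_C] at h
    rw [eq_C_of_natDegree_eq_zero h2, (map_eq_zero_iff _ hinj).mp h, C_0] at hp
    exact hp rfl
  · exact mem_invariants_iff_deg.mpr h2

theorem deg_aeval (φ : ExpMap k A) (a : A) (p : Polynomial k) :
    φ.deg (aeval a p) = p.natDegree * φ.deg a := by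
  have : φ.toFun (aeval a p) = (p.map (algebraMap k A)).comp (φ.toFun a) := by
    rw [← aeval_algHom_apply, comp, eval₂_map, aeval_def]
    rfl
  rw [deg, this, natDegree_comp, natDegree_map, deg]

/-- All degrees are multiples of the least positive one. -/
theorem dvd_deg (φ : ExpMap k A) {x : A} (hx : 0 < φ.deg x)
    (hmin : ∀ a, 0 < φ.deg a → φ.deg x ≤ φ.deg a) (a : A) : φ.deg x ∣ φ.deg a := by
  set d := φ.deg x with hd
  have hx0 : (φ.toFun x).coeff d ≠ 0 := φ.lead_ne_zero (by
    rintro rfl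
    rw [hd, deg, map_zero, natDegree_zero] at hx
    exact hx.false)
  have hchoose : ∀ i, 0 < i → i < d → ((d.choose i : ℕ) : A) = 0 := by
    intro i hi hid
    have h1 : φ.deg ((φ.toFun x).coeff i) = 0 := by
      by_contra hne
      have := hmin _ (Nat.pos_of_ne_zero hne)
      have := φ.deg_coeff_le x i
      omega
    have h2 := φ.coeff_toFun_coeff x i (d - i)
    rw [Nat.sub_add_cancel hid.le, coeff_eq_zero_of_natDegree_lt
      (show (φ.toFun ((φ.toFun x).coeff i)).natDegree < d - i by
        have : (φ.toFun ((φ.toFun x).coeff i)).natDegree = 0 := h1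
        omega)] at h2
    exact (mul_eq_zero.mp h2.symm).resolve_right hx0
  have hfrob : ((X : A[X]) + 1) ^ d = X ^ d + 1 := by
    ext n
    rw [coeff_X_add_one_pow, coeff_add, coeff_X_pow, coeff_one]
    rcases Nat.eq_zero_or_pos n with rfl | hn
    · simp [hx.ne]
    · rcases lt_trichotomy n d with h | h | h
      · simp [hchoose n hn h, h.ne, hn.ne']
      · simp [h, hx.ne']
      · simp [Nat.choose_eq_zero_of_lt h, h.ne', hn.ne']
  set n := φ.deg a with hn
  set q := n / d with hq
  set r := n % d with hr
  have hnqr : r + d * q = n := Nat.mod_add_div n d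
  have hrd : r < d := Nat.mod_lt _ hx
  have hone : ((n.choose (d * q) : ℕ) : A) = 1 := by
    rw [← coeff_X_add_one_pow, ← hnqr, pow_add, pow_mul, hfrob]
    have hexp : ((X : A[X]) ^ d + 1) ^ q = expand A d ((X + 1) ^ q) := by simp
    rw [hexp, coeff_mul, Finset.sum_eq_single (0, d * q)]
    · rw [mul_comm d q, coeff_expand_mul hx, coeff_X_add_one_pow, coeff_X_add_one_pow]
      simp
    · rintro ⟨i, j⟩ hij hne
      rw [Finset.HasAntidiagonal.mem_antidiagonal] at hij
      simp only at hij ⊢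
      by_cases hdj : d ∣ j
      · rw [coeff_X_add_one_pow, Nat.choose_eq_zero_of_lt, Nat.cast_zero, zero_mul]
        have hdi : d ∣ i := (Nat.dvd_add_left hdj).mp ⟨q, hij⟩
        rcases Nat.eq_zero_or_pos i with rfl | hi
        · exact absurd (by simpa using hij) (by simpa using hne)
        · exact hrd.trans_le (Nat.le_of_dvd hi hdi)
      · rw [coeff_expand hx, if_neg hdj, mul_zero]
    · simp
  rw [Nat.dvd_iff_mod_eq_zero, ← hr]
  by_contra hr0
  have hdeg : φ.deg ((φ.toFun a).coeff (d * q)) = r := by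
    refine le_antisymm ((φ.deg_coeff_le a _).trans (by omega)) ?_
    refine le_natDegree_of_ne_zero ?_
    rw [φ.coeff_toFun_coeff, hnqr, hone, one_mul]
    refine φ.lead_ne_zero ?_
    rintro rfl
    rw [deg, map_zero, natDegree_zero] at hn
    omega
  have := hmin _ (by rw [hdeg]; omega)
  omega

/-- If `x` has least positive degree, then `A` is contained in the polynomial ring in `x` over the
fraction field of the ring of invariants. -/
theorem exists_mul_mem_adjoin (φ : ExpMap k A) {x : A} (hx : 0 < φ.deg x)
    (hmin : ∀ a, 0 < φ.deg a → φ.deg x ≤ φ.deg a) (a : A) :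
    ∃ u ∈ φ.invariants, u ≠ 0 ∧
      u * a ∈ Algebra.adjoin k (insert x (φ.invariants : Set A)) := by
  have hinv : ∀ b ∈ φ.invariants, b ∈ Algebra.adjoin k (insert x (φ.invariants : Set A)) :=
    fun b hb => Algebra.subset_adjoin (Set.mem_insert_of_mem _ hb)
  have hx0 : x ≠ 0 := by
    rintro rfl
    rw [deg, map_zero, natDegree_zero] at hx
    exact hx.false
  induction hn : φ.deg a using Nat.strong_induction_on generalizing a with
  | _ n ih =>
    rcases Nat.eq_zero_or_pos n with rfl | hpos
    · refine ⟨1, φ.invariants.one_mem, one_ne_zero, ?_⟩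
      rw [one_mul]
      exact hinv a (mem_invariants_iff_deg.mpr hn)
    obtain ⟨q, hq⟩ := φ.dvd_deg hx hmin a
    have hdeg : φ.deg (φ.lead x ^ q * a - φ.lead a * x ^ q) < n := by
      have hl := mem_invariants.mp (φ.invariants.pow_mem (φ.lead_mem_invariants x) q)
      have hl' := mem_invariants.mp (φ.lead_mem_invariants a)
      have hform : φ.toFun (φ.lead x ^ q * a - φ.lead a * x ^ q) =
          C (φ.lead x ^ q) * φ.toFun a - C (φ.lead a) * φ.toFun (x ^ q) := by
        rw [map_sub, map_mul, map_mul, hl, hl']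
      have hxq : φ.deg (x ^ q) = n := by rw [deg_pow, ← hn, hq, mul_comm]
      refine φ.deg_lt_of_coeff_eq_zero hpos ?_ ?_
      · rw [deg, hform]
        refine (natDegree_sub_le _ _).trans (max_le ?_ ?_)
        · exact (natDegree_C_mul_le _ _).trans hn.le
        · exact (natDegree_C_mul_le _ _).trans hxq.le
      · rw [hform, coeff_sub, coeff_C_mul, coeff_C_mul]
        have h1 : (φ.toFun a).coeff n = φ.lead a := by rw [← hn]; rfl
        have h2 : (φ.toFun (x ^ q)).coeff n = φ.lead x ^ q := by
          rw [← lead_pow, ← hxq]; rfl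
        rw [h1, h2]
        ring
    obtain ⟨u, hu, hu0, hmem⟩ := ih _ hdeg _ rfl
    refine ⟨u * φ.lead x ^ q, φ.invariants.mul_mem hu
      (φ.invariants.pow_mem (φ.lead_mem_invariants x) q),
      mul_ne_zero hu0 (pow_ne_zero _ (φ.lead_ne_zero hx0)), ?_⟩
    have h3 : u * φ.lead x ^ q * a =
        u * (φ.lead x ^ q * a - φ.lead a * x ^ q) + u * φ.lead a * x ^ q := by ring
    rw [h3]
    exact add_mem hmem (mul_mem (mul_mem (hinv u hu) (hinv _ (φ.lead_mem_invariants a)))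
      (pow_mem (Algebra.subset_adjoin (Set.mem_insert _ _)) q))

end Domain

end ExpMap

namespace ExpMap

open Polynomial TensorProduct

section BaseChange

variable (L : Type*) [Field L] [Algebra k L]

/-- The underlying homomorphism of the base change of an exponential map. -/
noncomputable def baseChangeHom (φ : ExpMap k A) : L ⊗[k] A →ₐ[L] Polynomial (L ⊗[k] A) :=
  Algebra.TensorProduct.lift (Algebra.ofId L (Polynomial (L ⊗[k] A)))
    ((Polynomial.mapAlgHom (Algebra.TensorProduct.includeRight : A →ₐ[k] L ⊗[k] A)).comp φ.toFun)
    fun _ _ => Commute.all _ _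

theorem baseChangeHom_tmul (φ : ExpMap k A) (l : L) (a : A) :
    φ.baseChangeHom L (l ⊗ₜ a) = C (l ⊗ₜ[k] (1 : A)) *
      (φ.toFun a).map (Algebra.TensorProduct.includeRight : A →ₐ[k] L ⊗[k] A).toRingHom := by
  simp [baseChangeHom, Algebra.ofId_apply, Polynomial.algebraMap_apply]

/-- The base change of an exponential map to an extension field. -/
noncomputable def baseChange (φ : ExpMap k A) : ExpMap L (L ⊗[k] A) where
  toFun := φ.baseChangeHom L
  eval_zero r := by
    induction r with
    | zero => simp
    | add x y hx hy => rw [map_add, eval_add, hx, hy]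
    | tmul l a =>
      rw [baseChangeHom_tmul, eval_mul, eval_C, ← coeff_zero_eq_eval_zero, coeff_map,
        φ.coeff_zero]
      simp
  coaction r := by
    induction r with
    | zero => simp
    | add x y hx hy => rw [map_add, Polynomial.map_add, eval₂_add, hx, hy]
    | tmul l a =>
      set ι := (Algebra.TensorProduct.includeRight : A →ₐ[k] L ⊗[k] A).toRingHom with hι
      have h1 : (φ.baseChangeHom L).toRingHom.comp ι = (mapRingHom ι).comp φ.toFun.toRingHom := by
        ext1 b
        change φ.baseChangeHom L (1 ⊗ₜ b) = (φ.toFun b).map ι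
        rw [baseChangeHom_tmul, ← Algebra.TensorProduct.one_def, C_1, one_mul]
      have h2 : φ.baseChangeHom L (l ⊗ₜ[k] (1 : A)) = C (l ⊗ₜ[k] (1 : A)) := by
        rw [baseChangeHom_tmul, map_one, Polynomial.map_one, mul_one]
      rw [baseChangeHom_tmul, Polynomial.map_mul, eval₂_mul, map_C, eval₂_C, Polynomial.map_map,
        ← hι, h1, ← Polynomial.map_map, eval₂_map]
      congr 1
      · exact congrArg C h2
      · have h3 := congrArg (fun p => p.map (mapRingHom ι)) (φ.coaction a)
        rw [h3, ← coe_mapRingHom, hom_eval₂]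
        congr 1
        · ext1 b
          simp
        · simp

theorem baseChange_tmul (φ : ExpMap k A) (l : L) (a : A) :
    (φ.baseChange L).toFun (l ⊗ₜ a) = C (l ⊗ₜ[k] (1 : A)) *
      (φ.toFun a).map (Algebra.TensorProduct.includeRight : A →ₐ[k] L ⊗[k] A).toRingHom :=
  φ.baseChangeHom_tmul L l a

theorem baseChange_one_tmul (φ : ExpMap k A) (a : A) :
    (φ.baseChange L).toFun (1 ⊗ₜ a) =
      (φ.toFun a).map (Algebra.TensorProduct.includeRight : A →ₐ[k] L ⊗[k] A).toRingHom := by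
  rw [baseChange_tmul, ← Algebra.TensorProduct.one_def, C_1, one_mul]

theorem one_tmul_injective :
    Function.Injective (Algebra.TensorProduct.includeRight : A →ₐ[k] L ⊗[k] A) :=
  Algebra.TensorProduct.includeRight_injective (algebraMap k L).injective

theorem deg_baseChange (φ : ExpMap k A) (a : A) : (φ.baseChange L).deg (1 ⊗ₜ a) = φ.deg a := by
  rw [deg, baseChange_one_tmul, deg]
  exact natDegree_map_eq_of_injective (one_tmul_injective L) _

theorem lead_baseChange (φ : ExpMap k A) (a : A) :
    (φ.baseChange L).lead (1 ⊗ₜ a) = 1 ⊗ₜ φ.lead a := by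
  rw [lead, baseChange_one_tmul, lead]
  exact leadingCoeff_map_of_injective (one_tmul_injective L) _

variable {L}

/-- The `A`-coordinate of an element of `L ⊗ A` along a linear functional on `L`. -/
noncomputable def coord (ν : L →ₗ[k] k) : L ⊗[k] A →ₗ[k] A :=
  (TensorProduct.lid k A).toLinearMap ∘ₗ ν.rTensor A

theorem coord_tmul (ν : L →ₗ[k] k) (l : L) (a : A) : coord ν (l ⊗ₜ a) = ν l • a := by
  simp [coord]

theorem exists_coord_ne_zero {r : L ⊗[k] A} (hr : r ≠ 0) :
    ∃ ν : L →ₗ[k] k, coord ν r ≠ 0 := by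
  classical
  by_contra! h
  refine hr ((TensorProduct.equivFinsuppOfBasisLeft (Module.Basis.ofVectorSpace k L)).injective ?_)
  refine Finsupp.ext fun i => ?_
  rw [TensorProduct.equivFinsuppOfBasisLeft_apply, map_zero]
  exact h _

theorem coeff_toFun_coord (φ : ExpMap k A) (ν : L →ₗ[k] k) (r : L ⊗[k] A) (n : ℕ) :
    (φ.toFun (coord ν r)).coeff n = coord ν (((φ.baseChange L).toFun r).coeff n) := by
  induction r with
  | zero => simp
  | add x y hx hy => simp only [map_add, coeff_add, hx, hy]
  | tmul l a =>
    rw [baseChange_tmul, coeff_C_mul, coeff_map, coord_tmul]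
    change _ = coord ν ((l ⊗ₜ[k] (1 : A)) * ((1 : L) ⊗ₜ[k] ((φ.toFun a).coeff n)))
    rw [Algebra.TensorProduct.tmul_mul_tmul, mul_one, one_mul, coord_tmul, map_smul, coeff_smul]

theorem deg_coord_le (φ : ExpMap k A) (ν : L →ₗ[k] k) (r : L ⊗[k] A) :
    φ.deg (coord ν r) ≤ (φ.baseChange L).deg r := by
  refine natDegree_le_iff_coeff_eq_zero.mpr fun l hl => ?_
  rw [coeff_toFun_coord, coeff_eq_zero_of_natDegree_lt hl, map_zero]

theorem deg_coord_eq (φ : ExpMap k A) {ν : L →ₗ[k] k} {r : L ⊗[k] A}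
    (h : coord ν ((φ.baseChange L).lead r) ≠ 0) :
    φ.deg (coord ν r) = (φ.baseChange L).deg r ∧
      φ.lead (coord ν r) = coord ν ((φ.baseChange L).lead r) := by
  have h1 : (φ.toFun (coord ν r)).coeff ((φ.baseChange L).deg r) =
      coord ν ((φ.baseChange L).lead r) := coeff_toFun_coord φ ν r _
  have h2 : φ.deg (coord ν r) = (φ.baseChange L).deg r :=
    le_antisymm (φ.deg_coord_le ν r) (le_natDegree_of_ne_zero (by rwa [h1]))
  exact ⟨h2, by rw [← h1, ← h2]; rfl⟩

theorem coord_mem_invariants (φ : ExpMap k A) (ν : L →ₗ[k] k) {r : L ⊗[k] A}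
    (h : r ∈ (φ.baseChange L).invariants) : coord ν r ∈ φ.invariants := by
  rw [mem_invariants_iff_deg] at h ⊢
  have := φ.deg_coord_le ν r
  omega

end BaseChange

end ExpMap

namespace ExpMap

open Polynomial

section AlgClosed

variable {K R : Type*} [Field K] [CommRing R] [Algebra K R]

/-- Over an algebraically closed field, if `r` is algebraic modulo a prime `f`, then it is
congruent to a constant. -/
theorem exists_dvd_sub_algebraMap [IsAlgClosed K] {f r : R} (hf : Prime f)
    {q : Polynomial K} (hq : q ≠ 0) (h : f ∣ aeval r q) : ∃ c : K, f ∣ r - algebraMap K R c := by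
  induction hn : q.natDegree generalizing q with
  | zero =>
    rw [eq_C_of_natDegree_eq_zero hn, aeval_C] at h
    rw [eq_C_of_natDegree_eq_zero hn, Ne, C_eq_zero] at hq
    exact absurd (isUnit_of_dvd_unit h ((IsUnit.mk0 _ hq).map (algebraMap K R))) hf.not_isUnit
  | succ n ih =>
    obtain ⟨c, hc⟩ := IsAlgClosed.exists_root q (by
      rw [degree_eq_natDegree hq, hn]
      exact_mod_cast n.succ_ne_zero)
    obtain ⟨q', rfl⟩ := dvd_iff_isRoot.mpr hc
    rw [map_mul] at h
    rcases hf.dvd_or_dvd h with h | h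
    · exact ⟨c, by simpa using h⟩
    · have hq' : q' ≠ 0 := right_ne_zero_of_mul hq
      refine ih hq' h ?_
      rw [natDegree_mul (X_sub_C_ne_zero c) hq', natDegree_X_sub_C] at hn
      omega

variable [IsDomain R]

/-- A nontrivial exponential map on a ring of transcendence degree two has no two algebraically
independent invariants. -/
theorem not_algebraicIndependent (e : R ≃ₐ[K] MvPolynomial (Fin 2) K) (φ : ExpMap K R)
    {x f r : R} (hx : x ∉ φ.invariants) (hf : f ∈ φ.invariants) (hr : r ∈ φ.invariants) :
    ¬ AlgebraicIndependent K ![f, r] := by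
  intro h
  have htr : Algebra.trdeg K R = 2 := by
    have h1 := e.lift_trdeg_eq
    rw [MvPolynomial.trdeg_of_isDomain] at h1
    simpa using h1
  have hb : IsTranscendenceBasis K ![f, r] := by
    refine h.isTranscendenceBasis_of_lift_trdeg_le ?_ ?_
    · rw [htr]; exact Cardinal.natCast_lt_aleph0 (n := 2)
    · rw [htr]; simp
  have hle : Algebra.adjoin K (Set.range ![f, r]) ≤ φ.invariants := by
    refine Algebra.adjoin_le ?_
    rintro _ ⟨i, rfl⟩
    fin_cases i
    · exact hf
    · exact hr
  obtain ⟨p, hp0, hp⟩ := hb.isAlgebraic.isAlgebraic x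
  have hinj : Function.Injective (Subalgebra.inclusion hle).toRingHom :=
    Subalgebra.inclusion_injective hle
  refine hx (φ.mem_invariants_of_aeval_eq_zero (p := p.map (Subalgebra.inclusion hle).toRingHom)
    ((Polynomial.map_ne_zero_iff hinj).mpr hp0) ?_)
  rw [aeval_def, eval₂_map]
  exact hp

/-- Two algebraically dependent elements, one of which is prime: the other one is constant modulo
the prime one. -/
theorem exists_dvd_sub_algebraMap_of_not_algebraicIndependent [IsAlgClosed K] {f r : R}
    (hf : Prime f) (h : ¬ AlgebraicIndependent K ![f, r]) :
    ∃ c : K, f ∣ r - algebraMap K R c := by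
  let E : K[X][X] →+* R := eval₂RingHom (aeval r : K[X] →ₐ[K] R).toRingHom f
  have hE : ∃ P : K[X][X], P ≠ 0 ∧ E P = 0 := by
    rw [algebraicIndependent_iff] at h
    push Not at h
    obtain ⟨p, hp, hp0⟩ := h
    let F : MvPolynomial (Fin 2) K →+* K[X][X] :=
      (mapRingHom (MvPolynomial.uniqueAlgEquiv K (Fin 1)).toAlgHom.toRingHom).comp
        (MvPolynomial.finSuccEquiv K 1).toAlgHom.toRingHom
    have hF : Function.Injective F :=
      (map_injective _ (MvPolynomial.uniqueAlgEquiv K (Fin 1)).injective).comp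
        (MvPolynomial.finSuccEquiv K 1).injective
    refine ⟨F p, (map_ne_zero_iff F hF).mpr hp0, ?_⟩
    rw [← hp]
    change (E.comp F) p = (MvPolynomial.aeval ![f, r]).toRingHom p
    congr 1
    refine MvPolynomial.ringHom_ext ?_ ?_
    · intro c
      simp [E, F, MvPolynomial.finSuccEquiv_apply]
    · intro i
      fin_cases i
      · simp [E, F, MvPolynomial.finSuccEquiv_apply]
      · have h1 : MvPolynomial.finSuccEquiv K 1 (MvPolynomial.X 1) = C (MvPolynomial.X 0) :=
          MvPolynomial.finSuccEquiv_X_succ (j := 0)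
        simp [E, F, h1]
  obtain ⟨P, hP0, hP⟩ := hE
  obtain ⟨Q, hPQ, hQ⟩ := exists_eq_pow_rootMultiplicity_mul_and_not_dvd P hP0 0
  rw [C_0, sub_zero] at hPQ hQ
  rw [hPQ, map_mul, map_pow] at hP
  have hEX : E X = f := by simp [E]
  have hEQ : E Q = 0 := (mul_eq_zero.mp hP).resolve_left (pow_ne_zero _ (hEX ▸ hf.ne_zero))
  refine exists_dvd_sub_algebraMap hf (q := Q.coeff 0) (fun h0 => hQ (X_dvd_iff.mpr h0)) ?_
  have h2 := congrArg E (divX_mul_X_add Q)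
  rw [hEQ, map_add, map_mul, hEX] at h2
  have h3 : E (C (Q.coeff 0)) = aeval r (Q.coeff 0) := by simp [E]
  rw [h3] at h2
  exact (dvd_add_right (Dvd.intro_left _ rfl)).mp (h2 ▸ dvd_zero f)

/-- If an invariant prime is moved by a second exponential map, it generates the ring of
invariants. -/
theorem invariants_eq_adjoin_of_prime [IsAlgClosed K] (e : R ≃ₐ[K] MvPolynomial (Fin 2) K)
    (φ ψ : ExpMap K R) {x f : R} (hx : x ∉ φ.invariants) (hf : f ∈ φ.invariants) (hfp : Prime f)
    (hψ : 0 < ψ.deg f) : φ.invariants = Algebra.adjoin K {f} := by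
  refine le_antisymm (fun r hr => ?_) (Algebra.adjoin_le (Set.singleton_subset_iff.mpr hf))
  induction hn : ψ.deg r using Nat.strong_induction_on generalizing r with
  | _ n ih =>
    obtain ⟨c, s, hs⟩ := exists_dvd_sub_algebraMap_of_not_algebraicIndependent hfp
      (φ.not_algebraicIndependent e hx hf hr)
    have hr' : r = f * s + algebraMap K R c := by rw [← hs, sub_add_cancel]
    rw [hr']
    refine add_mem (mul_mem (Algebra.self_mem_adjoin_singleton K f) ?_)
      (Subalgebra.algebraMap_mem _ c)
    by_cases hs0 : s = 0
    · rw [hs0]; exact zero_mem _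
    have hfs : f * s ∈ φ.invariants := by
      rw [← hs]; exact sub_mem hr (φ.invariants.algebraMap_mem c)
    refine ih _ ?_ s (φ.mem_invariants_of_mul_mem hfs (mul_ne_zero hfp.ne_zero hs0)).2 rfl
    have h1 := ψ.deg_sub_algebraMap r c
    rw [hs, ψ.deg_mul hfp.ne_zero hs0] at h1
    omega

/-- The translates of a generator of the ring of invariants are prime. -/
theorem prime_sub_algebraMap [UniqueFactorizationMonoid R] (φ ψ : ExpMap K R) {b : R}
    (hb : φ.invariants = Algebra.adjoin K {b}) (hψ : 0 < ψ.deg b) (c : K) :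
    Prime (b - algebraMap K R c) := by
  rw [← UniqueFactorizationMonoid.irreducible_iff_prime]
  have hd := ψ.deg_sub_algebraMap b c
  have h0 : b - algebraMap K R c ≠ 0 := ψ.ne_zero_of_deg_pos (by omega)
  have hbmem : b ∈ φ.invariants := hb ▸ Algebra.self_mem_adjoin_singleton K b
  have hmem : b - algebraMap K R c ∈ φ.invariants :=
    sub_mem hbmem (φ.invariants.algebraMap_mem c)
  have hunit : ∀ g ∈ φ.invariants, g ≠ 0 → ψ.deg g = 0 → IsUnit g := by
    intro g hg hg0 hdeg
    rw [hb, Algebra.adjoin_singleton_eq_range_aeval] at hg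
    obtain ⟨p, rfl⟩ := hg
    change ψ.deg (aeval b p) = 0 at hdeg
    change aeval b p ≠ 0 at hg0
    change IsUnit (aeval b p)
    rw [deg_aeval, mul_eq_zero] at hdeg
    have hp := eq_C_of_natDegree_eq_zero (hdeg.resolve_right hψ.ne')
    rw [hp, aeval_C] at hg0 ⊢
    refine (IsUnit.mk0 _ fun h => hg0 ?_).map _
    rw [h, map_zero]
  refine ⟨fun hu => ?_, fun g h hgh => ?_⟩
  · have := ψ.deg_eq_zero_of_isUnit hu
    omega
  · rw [hgh] at hmem h0
    obtain ⟨hg, hh⟩ := φ.mem_invariants_of_mul_mem hmem h0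
    obtain ⟨hg0, hh0⟩ := mul_ne_zero_iff.mp h0
    rw [hgh, ψ.deg_mul hg0 hh0] at hd
    have hdvd : ∀ s ∈ φ.invariants, ψ.deg b ∣ ψ.deg s := by
      intro s hs
      rw [hb, Algebra.adjoin_singleton_eq_range_aeval] at hs
      obtain ⟨p, rfl⟩ := hs
      change _ ∣ ψ.deg (aeval b p)
      rw [deg_aeval]
      exact Dvd.intro_left _ rfl
    rcases Nat.eq_zero_or_pos (ψ.deg g) with h1 | h1
    · exact Or.inl (hunit g hg hg0 h1)
    · have := Nat.le_of_dvd h1 (hdvd g hg)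
      exact Or.inr (hunit h hh hh0 (by omega))

/-- A ring with invariants `K[b]` is generated by `b` and an element of least positive degree whose
leading coefficient is also least. -/
theorem adjoin_pair_eq_top [IsAlgClosed K] [UniqueFactorizationMonoid R] (φ ψ : ExpMap K R)
    {b x : R} (hb : φ.invariants = Algebra.adjoin K {b}) (hψ : 0 < ψ.deg b)
    (hx : 0 < φ.deg x) (hmin : ∀ a, 0 < φ.deg a → φ.deg x ≤ φ.deg a)
    (hlead : ∀ a, φ.deg a = φ.deg x → ψ.deg (φ.lead x) ≤ ψ.deg (φ.lead a)) :
    Algebra.adjoin K {b, x} = ⊤ := by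
  let E : K[X][X] →+* R := eval₂RingHom (aeval b : K[X] →ₐ[K] R).toRingHom x
  have hEC : ∀ p : K[X], E (C p) = aeval b p := fun p => by simp [E]
  have hEX : E X = x := by simp [E]
  have hErange : ∀ r, r ∈ Algebra.adjoin K {b, x} ↔ ∃ P, E P = r := by
    refine fun r => ⟨fun hr => ?_, ?_⟩
    · induction hr using Algebra.adjoin_induction with
      | mem y hy =>
        rcases hy with rfl | rfl
        · exact ⟨C X, by rw [hEC, aeval_X]⟩
        · exact ⟨X, hEX⟩
      | algebraMap c => exact ⟨C (C c), by rw [hEC, aeval_C]⟩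
      | add y z _ _ hy hz =>
        obtain ⟨P, rfl⟩ := hy
        obtain ⟨Q, rfl⟩ := hz
        exact ⟨P + Q, map_add E P Q⟩
      | mul y z _ _ hy hz =>
        obtain ⟨P, rfl⟩ := hy
        obtain ⟨Q, rfl⟩ := hz
        exact ⟨P * Q, map_mul E P Q⟩
    · rintro ⟨P, rfl⟩
      induction P using Polynomial.induction_on' with
      | add P Q hP hQ => rw [map_add]; exact add_mem hP hQ
      | monomial n p =>
        rw [← C_mul_X_pow_eq_monomial, map_mul, map_pow, hEX, hEC]
        refine mul_mem ?_ (pow_mem (Algebra.subset_adjoin (by simp)) n)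
        have h1 : Algebra.adjoin K {b} ≤ Algebra.adjoin K {b, x} := Algebra.adjoin_mono (by simp)
        exact h1 (Polynomial.aeval_mem_adjoin_singleton K b)
  have hcancel : ∀ u : K[X], u ≠ 0 → ∀ (r : R) (P : K[X][X]), E (C u) * r = E P →
      ∃ Q, E Q = r := by
    intro u hu
    induction hn : u.natDegree generalizing u with
    | zero =>
      intro r P h
      have hc := eq_C_of_natDegree_eq_zero hn
      have hc0 : u.coeff 0 ≠ 0 := fun h => hu (by rw [hc, h, C_0])
      refine ⟨C (C (u.coeff 0)⁻¹) * P, ?_⟩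
      rw [map_mul, ← h, hEC, hEC, ← mul_assoc, ← map_mul]
      nth_rw 2 [hc]
      rw [← C_mul, inv_mul_cancel₀ hc0, C_1, map_one, one_mul]
    | succ n ih =>
      intro r P h
      obtain ⟨c, hc⟩ := IsAlgClosed.exists_root u (by
        rw [degree_eq_natDegree hu, hn]
        exact_mod_cast n.succ_ne_zero)
      obtain ⟨v, rfl⟩ := dvd_iff_isRoot.mpr hc
      have hv : v ≠ 0 := right_ne_zero_of_mul hu
      have hvn : v.natDegree = n := by
        rw [natDegree_mul (X_sub_C_ne_zero c) hv, natDegree_X_sub_C] at hn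
        omega
      have hπ := φ.prime_sub_algebraMap ψ hb hψ c
      set π := b - algebraMap K R c with hπdef
      have hEπ : E (C (X - C c)) = π := by rw [hEC]; simp [hπdef]
      rw [C_mul, map_mul, hEπ, mul_assoc] at h
      have hdvd : C (X - C c) ∣ P := by
        set P₀ : K[X] := P.map (evalRingHom c) with hP₀
        have hPP : C (X - C c) ∣ P - P₀.map C := by
          rw [C_dvd_iff_dvd_coeff]
          intro i
          rw [coeff_sub, coeff_map, hP₀, coeff_map]
          exact X_sub_C_dvd_sub_C_eval
        by_cases h0 : P₀ = 0
        · rwa [h0, Polynomial.map_zero, sub_zero] at hPP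
        exfalso
        have hE0 : E (P₀.map C) = aeval x P₀ := by
          simp only [E, coe_eval₂RingHom, eval₂_map, aeval_def]
          congr 1
          ext1 t
          simp
        have h1 : π ∣ aeval x P₀ := by
          have h2 := map_dvd E hPP
          rw [hEπ, map_sub, hE0, ← h] at h2
          exact (dvd_sub_right (Dvd.intro _ rfl)).mp h2
        obtain ⟨μ, y, hy⟩ := exists_dvd_sub_algebraMap hπ h0 h1
        have hdy := φ.deg_sub_algebraMap x μ
        have hdπ := ψ.deg_sub_algebraMap b c
        rw [← hπdef] at hdπ
        have hy0 : y ≠ 0 := by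
          rintro rfl
          rw [hy, mul_zero, deg, map_zero, natDegree_zero] at hdy
          omega
        have hπmem : π ∈ φ.invariants :=
          sub_mem (hb ▸ Algebra.self_mem_adjoin_singleton K b) (φ.invariants.algebraMap_mem c)
        have hlx : φ.lead (x - algebraMap K R μ) = φ.lead x := by
          rw [lead, map_sub, mem_invariants.mp (φ.invariants.algebraMap_mem μ)]
          refine leadingCoeff_sub_of_degree_lt (lt_of_le_of_lt degree_C_le ?_)
          exact natDegree_pos_iff_degree_pos.mp hx
        have hlπ : φ.lead π = π := by rw [lead, mem_invariants.mp hπmem, leadingCoeff_C]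
        rw [hy, lead_mul, hlπ] at hlx
        rw [hy, φ.deg_mul hπ.ne_zero hy0, mem_invariants_iff_deg.mp hπmem, zero_add] at hdy
        have h5 := hlead y hdy
        rw [← hlx, ψ.deg_mul hπ.ne_zero (φ.lead_ne_zero hy0)] at h5
        omega
      obtain ⟨Q, rfl⟩ := hdvd
      rw [map_mul, hEπ] at h
      exact ih v hv hvn r Q (mul_left_cancel₀ hπ.ne_zero h)
  refine eq_top_iff.mpr fun r _ => ?_
  obtain ⟨u, hu, hu0, hmem⟩ := φ.exists_mul_mem_adjoin hx hmin r
  have hle : Algebra.adjoin K (insert x (φ.invariants : Set R)) ≤ Algebra.adjoin K {b, x} := by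
    refine Algebra.adjoin_le (Set.insert_subset (Algebra.subset_adjoin (by simp)) ?_)
    rw [hb]
    exact Algebra.adjoin_mono (by simp)
  rw [hb, Algebra.adjoin_singleton_eq_range_aeval] at hu
  obtain ⟨p, rfl⟩ := hu
  obtain ⟨P, hP⟩ := (hErange _).mp (hle hmem)
  refine (hErange r).mpr (hcancel p ?_ r P ?_)
  · rintro rfl
    exact hu0 (map_zero (aeval b))
  · rw [hP, hEC]
    rfl

end AlgClosed

end ExpMap

namespace ExpMap

open TensorProduct

section Descent

variable {K : Type*} [Field K] [Algebra k K]

/-- If the base changes of elements of `s` generate `K ⊗ A`, then `s` generates `A`. -/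
theorem adjoin_eq_top_of_baseChange (s : Set A)
    (h : Algebra.adjoin K ((fun a => (1 : K) ⊗ₜ[k] a) '' s) = ⊤) : Algebra.adjoin k s = ⊤ := by
  have htop : (Algebra.adjoin k s).baseChange K = ⊤ := by
    refine top_le_iff.mp (h ▸ Algebra.adjoin_le ?_)
    rintro _ ⟨a, ha, rfl⟩
    exact Subalgebra.tmul_mem_baseChange (Algebra.subset_adjoin ha) 1
  obtain ⟨ν, hν⟩ : ∃ ν : K →ₗ[k] k, ν 1 = 1 := by
    obtain ⟨g, hg⟩ := (Algebra.linearMap k K).exists_leftInverse_of_injective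
      (LinearMap.ker_eq_bot.mpr (algebraMap k K).injective)
    exact ⟨g, by simpa using LinearMap.congr_fun hg 1⟩
  refine eq_top_iff.mpr fun a _ => ?_
  have hmem : ∀ r : K ⊗[k] A, r ∈ (Algebra.adjoin k s).baseChange K →
      coord ν r ∈ Algebra.adjoin k s := by
    rintro _ ⟨t, rfl⟩
    change coord ν (Algebra.TensorProduct.map (AlgHom.id K K) (Algebra.adjoin k s).val t) ∈ _
    induction t with
    | zero => simp
    | add x y hx hy => rw [map_add, map_add]; exact add_mem hx hy
    | tmul l c =>
      rw [Algebra.TensorProduct.map_tmul, coord_tmul]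
      exact Subalgebra.smul_mem _ c.2 _
  have h1 := hmem (1 ⊗ₜ a) (htop ▸ Algebra.mem_top)
  rwa [coord_tmul, hν, one_smul] at h1

theorem ringKrullDim_eq_two {R : Type*} [CommRing R] [Algebra K R]
    (e : R ≃ₐ[K] MvPolynomial (Fin 2) K) : ringKrullDim R = 2 := by
  rw [ringKrullDim_eq_of_ringEquiv e.toRingEquiv, MvPolynomial.ringKrullDim_of_isNoetherianRing,
    ringKrullDim_eq_zero_of_field]
  simp

/-- A form of the affine plane is not generated by a single element. -/
theorem adjoin_singleton_ne_top (e : K ⊗[k] A ≃ₐ[K] MvPolynomial (Fin 2) K) (x : A) :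
    Algebra.adjoin k {x} ≠ ⊤ := by
  intro h
  have htop : Algebra.adjoin K {(1 : K) ⊗ₜ[k] x} = ⊤ := by
    refine eq_top_iff.mpr fun r _ => ?_
    induction r with
    | zero => exact zero_mem _
    | add y z hy hz => exact add_mem (hy Algebra.mem_top) (hz Algebra.mem_top)
    | tmul l a =>
      have ha : a ∈ Algebra.adjoin k {x} := h ▸ Algebra.mem_top
      rw [Algebra.adjoin_singleton_eq_range_aeval] at ha
      obtain ⟨p, rfl⟩ := ha
      have h1 : l ⊗ₜ[k] (Polynomial.aeval x p) =
          l • Polynomial.aeval ((1 : K) ⊗ₜ[k] x) p := by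
        have h2 := Polynomial.aeval_algHom_apply
          (Algebra.TensorProduct.includeRight : A →ₐ[k] K ⊗[k] A) x p
        simp only [Algebra.TensorProduct.includeRight_apply] at h2
        rw [h2, TensorProduct.smul_tmul', smul_eq_mul, mul_one]
      change l ⊗ₜ[k] (Polynomial.aeval x p) ∈ _
      rw [h1]
      refine Subalgebra.smul_mem _ ?_ _
      rw [← Polynomial.aeval_map_algebraMap K]
      exact Polynomial.aeval_mem_adjoin_singleton K _
  rw [Algebra.adjoin_singleton_eq_range_aeval] at htop
  have hsurj : Function.Surjective (Polynomial.aeval (R := K) ((1 : K) ⊗ₜ[k] x)).toRingHom := by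
    intro r
    have hr : r ∈ (Polynomial.aeval (R := K) ((1 : K) ⊗ₜ[k] x)).range := htop ▸ Algebra.mem_top
    exact hr
  have hle := ringKrullDim_le_of_surjective _ hsurj
  rw [ringKrullDim_eq_two e, Polynomial.ringKrullDim_of_isNoetherianRing,
    ringKrullDim_eq_zero_of_field, zero_add] at hle
  exact absurd hle (by decide)

/-- A pair of elements that generates a form of the affine plane over an extension field is a
pair of coordinates. -/
theorem nonempty_algEquiv_of_adjoin_pair (e : K ⊗[k] A ≃ₐ[K] MvPolynomial (Fin 2) K) {b x : A}
    (h : Algebra.adjoin K {(1 : K) ⊗ₜ[k] b, (1 : K) ⊗ₜ[k] x} = ⊤) :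
    Nonempty (A ≃ₐ[k] MvPolynomial (Fin 2) k) := by
  have hrange : Set.range ![b, x] = {b, x} := by simp [Set.pair_comm]
  have hrange' : Set.range ![(1 : K) ⊗ₜ[k] b, (1 : K) ⊗ₜ[k] x] =
      {(1 : K) ⊗ₜ[k] b, (1 : K) ⊗ₜ[k] x} := by
    simp [Set.pair_comm]
  have hsurj : Function.Surjective (MvPolynomial.aeval (R := k) ![b, x]) := by
    rw [← AlgHom.range_eq_top, ← Algebra.adjoin_range_eq_range_aeval, hrange]
    refine adjoin_eq_top_of_baseChange (K := K) _ ?_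
    rwa [Set.image_pair]
  have hK : Function.Surjective
      (MvPolynomial.aeval (R := K) ![(1 : K) ⊗ₜ[k] b, (1 : K) ⊗ₜ[k] x]) := by
    rwa [← AlgHom.range_eq_top, ← Algebra.adjoin_range_eq_range_aeval, hrange']
  have hindK : AlgebraicIndependent K ![(1 : K) ⊗ₜ[k] b, (1 : K) ⊗ₜ[k] x] := by
    rw [algebraicIndependent_iff]
    intro p hp
    by_contra hp0
    have h1 := ringKrullDim_quotient_succ_le_of_nonZeroDivisor
      (mem_nonZeroDivisors_of_ne_zero hp0)
    have h2 := ringKrullDim_le_of_surjective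
      (Ideal.Quotient.lift (Ideal.span {p})
        (MvPolynomial.aeval (R := K) ![(1 : K) ⊗ₜ[k] b, (1 : K) ⊗ₜ[k] x]).toRingHom (by
          intro a ha
          obtain ⟨c, rfl⟩ := Ideal.mem_span_singleton'.mp ha
          rw [map_mul]
          exact mul_eq_zero_of_right _ hp))
      (Ideal.Quotient.lift_surjective_of_surjective _ _ hK)
    rw [ringKrullDim_eq_two e] at h2
    rw [ringKrullDim_eq_two (AlgEquiv.refl : MvPolynomial (Fin 2) K ≃ₐ[K] _)] at h1
    exact absurd ((add_le_add_left h2 1).trans h1) (by decide)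
  have hind : AlgebraicIndependent k ![b, x] := by
    refine AlgebraicIndependent.of_comp
      (Algebra.TensorProduct.includeRight : A →ₐ[k] K ⊗[k] A) ?_
    have h3 := hindK.restrictScalars (R := k) (algebraMap k K).injective
    convert h3 using 1
    ext i
    fin_cases i <;> rfl
  exact ⟨(AlgEquiv.ofBijective _ ⟨hind, hsurj⟩).symm⟩

theorem exists_isDomain_uniqueFactorizationMonoid {R : Type*} [CommRing R] [Algebra K R]
    (e : R ≃ₐ[K] MvPolynomial (Fin 2) K) : IsDomain R ∧ UniqueFactorizationMonoid R :=
  ⟨e.toMulEquiv.isDomain _, e.toMulEquiv.symm.uniqueFactorizationMonoid inferInstance⟩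

/-- A form of the affine plane over an algebraically closed extension with trivial
Makar-Limanov invariant is trivial. -/
theorem nonempty_algEquiv_of_iInf_eq_bot [IsAlgClosed K]
    (e : K ⊗[k] A ≃ₐ[K] MvPolynomial (Fin 2) K)
    (h : (⨅ φ : ExpMap k A, φ.invariants) = ⊥) : Nonempty (A ≃ₐ[k] MvPolynomial (Fin 2) k) := by
  obtain ⟨hdom, hufd⟩ := exists_isDomain_uniqueFactorizationMonoid e
  have hdomA : IsDomain A := (one_tmul_injective (k := k) (A := A) K).isDomain
    (Algebra.TensorProduct.includeRight : A →ₐ[k] K ⊗[k] A).toRingHom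
  have hmove : ∀ a : A, a ∉ (⊥ : Subalgebra k A) → ∃ φ : ExpMap k A, a ∉ φ.invariants := by
    intro a ha
    rw [← h] at ha
    simpa [Algebra.mem_iInf] using ha
  obtain ⟨a, ha⟩ : ∃ a : A, a ∉ (⊥ : Subalgebra k A) := by
    by_contra! hall
    exact adjoin_singleton_ne_top e 0
      (eq_top_iff.mpr fun a _ => (bot_le : ⊥ ≤ Algebra.adjoin k {(0 : A)}) (hall a))
  obtain ⟨φ, hφ⟩ := hmove a ha
  obtain ⟨x, hx, hmin, ψ, b, hb, hψb, hlead⟩ : ∃ x, 0 < φ.deg x ∧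
      (∀ y, 0 < φ.deg y → φ.deg x ≤ φ.deg y) ∧ ∃ (ψ : ExpMap k A), ∃ b ∈ φ.invariants,
      0 < ψ.deg b ∧ ∀ y, φ.deg y = φ.deg x → ψ.deg (φ.lead x) ≤ ψ.deg (φ.lead y) := by
    have hpos : ∃ y, 0 < φ.deg y := ⟨a, Nat.pos_of_ne_zero fun h0 =>
      hφ (mem_invariants_iff_deg.mpr h0)⟩
    obtain ⟨z, hz, hzmin⟩ : ∃ z, 0 < φ.deg z ∧ ∀ y, 0 < φ.deg y → φ.deg z ≤ φ.deg y := by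
      obtain ⟨z, hz, hz'⟩ := exists_minimalFor_of_wellFoundedLT (fun y => 0 < φ.deg y) φ.deg hpos
      exact ⟨z, hz, fun y hy => (le_total _ _).elim id fun hle => hz' hy hle⟩
    obtain ⟨b, hb, hb'⟩ : ∃ b ∈ φ.invariants, b ∉ (⊥ : Subalgebra k A) := by
      by_contra! hall
      refine adjoin_singleton_ne_top e z (eq_top_iff.mpr fun y _ => ?_)
      obtain ⟨u, hu, hu0, hmem⟩ := φ.exists_mul_mem_adjoin hz hzmin y
      obtain ⟨c, rfl⟩ := Algebra.mem_bot.mp (hall u hu)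
      have hle : Algebra.adjoin k (insert z (φ.invariants : Set A)) ≤ Algebra.adjoin k {z} := by
        refine Algebra.adjoin_le (Set.insert_subset (Algebra.self_mem_adjoin_singleton k z) ?_)
        exact fun t ht => (bot_le : ⊥ ≤ Algebra.adjoin k {z}) (hall t ht)
      have hc0 : c ≠ 0 := fun h0 => hu0 (by rw [h0, map_zero])
      have h1 := Subalgebra.smul_mem _ (hle hmem) c⁻¹
      rwa [← Algebra.smul_def, smul_smul, inv_mul_cancel₀ hc0, one_smul] at h1
    obtain ⟨ψ, hψ⟩ := hmove b hb'
    obtain ⟨x, hx, hx'⟩ := exists_minimalFor_of_wellFoundedLT (fun y => φ.deg y = φ.deg z)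
      (fun y => ψ.deg (φ.lead y)) ⟨z, rfl⟩
    refine ⟨x, by rwa [hx], fun y hy => by rw [hx]; exact hzmin y hy, ψ, b, hb,
      Nat.pos_of_ne_zero fun h0 => hψ (mem_invariants_iff_deg.mpr h0), fun y hy => ?_⟩
    exact (le_total _ _).elim id fun hle => hx' (hy.trans hx) hle
  set Φ := φ.baseChange K with hΦ
  set Ψ := ψ.baseChange K with hΨ
  have hxΦ : (1 : K) ⊗ₜ[k] x ∉ Φ.invariants := by
    rw [mem_invariants_iff_deg, hΦ, deg_baseChange]
    exact hx.ne'
  have hone : ∀ c ∈ φ.invariants, (1 : K) ⊗ₜ[k] c ∈ Φ.invariants := by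
    intro c hc
    rw [mem_invariants_iff_deg] at hc ⊢
    rw [hΦ, deg_baseChange, hc]
  obtain ⟨f, hf, hfp, hfΨ⟩ : ∃ f ∈ Φ.invariants, Prime f ∧ 0 < Ψ.deg f := by
    have key : ∀ r : K ⊗[k] A, r ∈ Φ.invariants → 0 < Ψ.deg r →
        ∃ f ∈ Φ.invariants, Prime f ∧ 0 < Ψ.deg f := by
      intro r
      induction r using WfDvdMonoid.induction_on_irreducible with
      | zero => exact fun _ h0 => absurd rfl (Ψ.ne_zero_of_deg_pos h0)
      | unit u hu =>
        intro _ h0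
        rw [Ψ.deg_eq_zero_of_isUnit hu] at h0
        exact absurd h0 (lt_irrefl 0)
      | mul r i hr0 hi ih =>
        intro hmem h0
        have hne := mul_ne_zero hi.ne_zero hr0
        obtain ⟨h1, h2⟩ := Φ.mem_invariants_of_mul_mem hmem hne
        rw [Ψ.deg_mul hi.ne_zero hr0] at h0
        rcases Nat.eq_zero_or_pos (Ψ.deg i) with h3 | h3
        · exact ih h2 (by omega)
        · exact ⟨i, h1, UniqueFactorizationMonoid.irreducible_iff_prime.mp hi, h3⟩
    exact key _ (hone b hb) (by rwa [hΨ, deg_baseChange])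
  have hadj := invariants_eq_adjoin_of_prime e Φ Ψ hxΦ hf hfp hfΨ
  obtain ⟨c, hc, hcΨ⟩ : ∃ c ∈ φ.invariants, ψ.deg c = Ψ.deg f := by
    obtain ⟨ν, hν⟩ := exists_coord_ne_zero (Ψ.lead_ne_zero hfp.ne_zero)
    exact ⟨coord ν f, φ.coord_mem_invariants ν hf, (ψ.deg_coord_eq hν).1⟩
  have hadjc : Φ.invariants = Algebra.adjoin K {(1 : K) ⊗ₜ[k] c} := by
    refine le_antisymm ?_ (Algebra.adjoin_le (Set.singleton_subset_iff.mpr (hone c hc)))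
    have hcmem := hone c hc
    rw [hadj, Algebra.adjoin_singleton_eq_range_aeval] at hcmem
    obtain ⟨p, hp⟩ := hcmem
    change Polynomial.aeval f p = _ at hp
    have hdeg : p.natDegree = 1 := by
      have h1 := Ψ.deg_aeval f p
      rw [hp, hΨ, deg_baseChange, hcΨ] at h1
      exact (Nat.eq_of_mul_eq_mul_right hfΨ (by rw [one_mul]; exact h1)).symm
    obtain ⟨s, hs, t, rfl⟩ := Polynomial.natDegree_eq_one.mp hdeg
    rw [hadj]
    refine Algebra.adjoin_le (Set.singleton_subset_iff.mpr ?_)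
    have hfeq : f = s⁻¹ • ((1 : K) ⊗ₜ[k] c - algebraMap K _ t) := by
      rw [← hp, map_add, map_mul, Polynomial.aeval_C, Polynomial.aeval_C, Polynomial.aeval_X,
        add_sub_cancel_right, ← Algebra.smul_def, smul_smul, inv_mul_cancel₀ hs, one_smul]
    rw [SetLike.mem_coe, hfeq]
    exact Subalgebra.smul_mem _ (sub_mem (Algebra.self_mem_adjoin_singleton K _)
      (Subalgebra.algebraMap_mem _ t)) _
  have hcpos : 0 < Ψ.deg ((1 : K) ⊗ₜ[k] c) := by
    rw [hΨ, deg_baseChange, hcΨ]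
    exact hfΨ
  refine nonempty_algEquiv_of_adjoin_pair e
    (adjoin_pair_eq_top Φ Ψ hadjc hcpos (x := (1 : K) ⊗ₜ[k] x) ?_ ?_ ?_)
  · rwa [hΦ, deg_baseChange]
  · intro r hr
    obtain ⟨ν, hν⟩ := exists_coord_ne_zero (Φ.lead_ne_zero (Φ.ne_zero_of_deg_pos hr))
    have h1 := (φ.deg_coord_eq hν).1
    rw [hΦ, deg_baseChange, ← h1]
    exact hmin _ (by rw [h1]; exact hr)
  · intro r hr
    have hr0 : r ≠ 0 := Φ.ne_zero_of_deg_pos (by rwa [hr, hΦ, deg_baseChange])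
    obtain ⟨ν, hν⟩ := exists_coord_ne_zero (Φ.lead_ne_zero hr0)
    obtain ⟨h1, h2⟩ := φ.deg_coord_eq hν
    rw [hΦ, lead_baseChange, hΨ, deg_baseChange]
    refine (hlead (coord ν r) ?_).trans ?_
    · rw [h1, ← hΦ, hr, hΦ, deg_baseChange]
    · rw [h2]
      exact ψ.deg_coord_le ν _

end Descent

end ExpMap

namespace ExpMap

open Polynomial in
/-- The translation of the `i`-th coordinate on a polynomial ring. -/
noncomputable def translationHom (k : Type*) [Field k] {σ : Type*} [DecidableEq σ] (i : σ) :
    MvPolynomial σ k →ₐ[k] (MvPolynomial σ k)[X] :=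
  MvPolynomial.aeval fun j => C (MvPolynomial.X j) + if j = i then X else 0

/-- The translation of the `i`-th coordinate, transported along an isomorphism with a polynomial
ring. -/
noncomputable def translation {σ : Type*} [DecidableEq σ] (e : A ≃ₐ[k] MvPolynomial σ k) (i : σ) :
    ExpMap k A where
  toFun := (Polynomial.mapAlgHom (e.symm : MvPolynomial σ k →ₐ[k] A)).comp
    ((translationHom k i).comp (e : A →ₐ[k] MvPolynomial σ k))
  eval_zero := by
    intro a
    obtain ⟨p, rfl⟩ := e.symm.surjective a
    simp only [AlgHom.comp_apply, Polynomial.coe_mapAlgHom, translationHom]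
    induction p using MvPolynomial.induction_on with
    | C r => simp [MvPolynomial.algHom_C, ← MvPolynomial.algebraMap_eq]
    | add p q hp hq => simp_all
    | mul_X p j hp =>
      by_cases h : j = i <;> simp_all
  coaction := by
    intro a
    obtain ⟨p, rfl⟩ := e.symm.surjective a
    set F := (Polynomial.mapAlgHom (e.symm : MvPolynomial σ k →ₐ[k] A)).comp
      ((translationHom k i).comp (e : A →ₐ[k] MvPolynomial σ k)) with hF
    have hX : ∀ j, F (e.symm (MvPolynomial.X j)) =
        Polynomial.C (e.symm (MvPolynomial.X j)) + if j = i then Polynomial.X else 0 := by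
      intro j
      by_cases h : j = i <;> simp [hF, translationHom, h]
    have hC : ∀ r, F (algebraMap k A r) = Polynomial.C (algebraMap k A r) := fun r =>
      F.commutes r
    clear_value F
    induction p using MvPolynomial.induction_on with
    | C r =>
      rw [← MvPolynomial.algebraMap_eq, AlgEquiv.commutes, hC]
      simp [hC]
    | add p q hp hq =>
      rw [map_add, map_add, Polynomial.map_add, Polynomial.eval₂_add, hp, hq]
    | mul_X p j hp =>
      rw [map_mul, map_mul, Polynomial.map_mul, Polynomial.eval₂_mul, hp, hX]
      congr 1
      by_cases h : j = i <;> simp [hX, h, add_comm, add_left_comm]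

theorem translationHom_eq_of_mem_invariants {σ : Type*} [DecidableEq σ]
    {e : A ≃ₐ[k] MvPolynomial σ k} {i : σ} {a : A} (h : a ∈ (translation e i).invariants) :
    translationHom k i (e a) = Polynomial.C (e a) := by
  have h1 : Polynomial.mapAlgHom (e.symm : MvPolynomial σ k →ₐ[k] A) (translationHom k i (e a)) =
      Polynomial.C a := h
  have h2 := congrArg (Polynomial.mapAlgHom (e : A →ₐ[k] MvPolynomial σ k)) h1
  rw [Polynomial.coe_mapAlgHom, Polynomial.coe_mapAlgHom, Polynomial.map_map] at h2
  have h3 : ((e : A →ₐ[k] MvPolynomial σ k) : A →+* MvPolynomial σ k).comp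
      ((e.symm : MvPolynomial σ k →ₐ[k] A) : MvPolynomial σ k →+* A) = RingHom.id _ := by
    ext <;> simp
  rw [h3, Polynomial.map_id] at h2
  simpa using h2

/-- A polynomial fixed by the translation of a coordinate is unchanged by substituting `0` for
that coordinate, whatever is substituted for the others. -/
theorem aeval_update_zero {σ : Type*} [DecidableEq σ] {i : σ} {p : MvPolynomial σ k}
    (h : translationHom k i p = Polynomial.C p) (v : σ → MvPolynomial σ k) :
    MvPolynomial.aeval (Function.update v i 0) p = MvPolynomial.aeval v p := by
  have h1 : (Polynomial.eval₂RingHom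
      ((MvPolynomial.aeval (R := k) (Function.update v i 0)).toRingHom) (v i))
      (translationHom k i p) = MvPolynomial.aeval v p := by
    clear h
    induction p using MvPolynomial.induction_on with
    | C r => simp [translationHom, MvPolynomial.algHom_C]
    | add p q hp hq => rw [map_add, map_add, map_add, hp, hq]
    | mul_X p j hp =>
      rw [map_mul, map_mul, map_mul, hp]
      congr 1
      by_cases h : j = i
      · subst h; simp [translationHom]
      · simp [translationHom, h]
  rw [h] at h1
  simpa using h1

/-- The Makar-Limanov invariant of a polynomial ring in two variables is trivial. -/
theorem iInf_eq_bot_of_algEquiv (e : A ≃ₐ[k] MvPolynomial (Fin 2) k) :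
    (⨅ φ : ExpMap k A, φ.invariants) = ⊥ := by
  refine eq_bot_iff.mpr fun a ha => ?_
  rw [Algebra.mem_iInf] at ha
  have h0 := fun i v => aeval_update_zero (translationHom_eq_of_mem_invariants
    (ha (translation e i))) v
  have h1 := (h0 1 _).trans (h0 0 MvPolynomial.X)
  have hv : Function.update (Function.update (MvPolynomial.X : Fin 2 → MvPolynomial (Fin 2) k) 0 0)
      1 0 = 0 := by
    ext i : 1
    fin_cases i <;> simp
  rw [hv, MvPolynomial.aeval_X_left_apply] at h1
  refine Algebra.mem_bot.mpr ⟨MvPolynomial.constantCoeff (e a), e.injective ?_⟩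
  exact (e.commutes _).trans ((MvPolynomial.aeval_zero _).symm.trans h1)

end ExpMap

/-- An `𝔸²`-form `A` over `k` is trivial iff its Makar-Limanov invariant
`ML(A) = ⋂_φ A^φ` equals `k`. -/
theorem ML_trivial_iff_form_trivial (L : Type*) [Field L] [Algebra k L]
    (hform : Nonempty ((TensorProduct k L A) ≃ₐ[L] MvPolynomial (Fin 2) L)) :
    (⨅ φ : ExpMap k A, φ.invariants) = ⊥ ↔ Nonempty (A ≃ₐ[k] MvPolynomial (Fin 2) k) := by
  refine ⟨fun h => ?_, fun ⟨e⟩ => ExpMap.iInf_eq_bot_of_algEquiv e⟩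
  obtain ⟨e⟩ := hform
  let K := AlgebraicClosure L
  let e' : TensorProduct k K A ≃ₐ[K] MvPolynomial (Fin 2) K :=
    ((Algebra.TensorProduct.cancelBaseChange k L K K A).symm.trans
      (Algebra.TensorProduct.congr AlgEquiv.refl e)).trans
      (MvPolynomial.algebraTensorAlgEquiv L K)
  exact ExpMap.nonempty_algEquiv_of_iInf_eq_bot e' h
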